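/- Let D = Σ_j D_{L_j} be a total dissipator on M_d(ℂ) and define r(D) := min over unit vectors u, v ∈ ℂ^d with ⟨u, v⟩ = 0 of Σ_j |⟨v, L_j u⟩|². If r(D) > 0, then for every time-dependent Hermitian Hamiltonian H (with continuous entries), every pair of solutions ρ, σ of the master equation for L_t = −i[H(t), ·] + D whose values at time s are density matrices satisfies ‖ρ(t) − σ(t)‖₁ ≤ e^{−d·r(D)·(t−s)}·‖ρ(s) − σ(s)‖₁ for all t ≥ s ≥ 0; that is, D is Hamiltonian-independently contractive with contraction rate at least d·r(D) and constant K = 1. -/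

import Mathlib

open scoped ComplexOrder Kronecker
open Matrix

namespace Paper

variable {n : Type*} [Fintype n] [DecidableEq n]

/-- Trace norm: sum of singular values. -/
noncomputable def traceNorm (A : Matrix n n ℂ) : ℝ :=
  ∑ i, Real.sqrt ((Matrix.posSemidef_conjTranspose_mul_self A).isHermitian.eigenvalues i)

/-- The dissipator associated with a single jump operator. -/
noncomputable def dissipator (L x : Matrix n n ℂ) : Matrix n n ℂ :=
  L * x * Lᴴ - ((1 : ℂ)/2) • (Lᴴ * L * x + x * (Lᴴ * L))

/-- Total dissipator of a family of jump operators. -/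
noncomputable def totalDissipator {m : ℕ} (L : Fin m → Matrix n n ℂ) (x : Matrix n n ℂ) :
    Matrix n n ℂ :=
  ∑ j, dissipator (L j) x

/-- The Hamiltonian commutator term `-i[H, x]`. -/
noncomputable def hamTerm (H x : Matrix n n ℂ) : Matrix n n ℂ :=
  (-Complex.I) • (H * x - x * H)

/-- A solution of the master equation `ρ' = L_t(ρ)` starting at time `s`
(differentiable entrywise). -/
def IsSolution (Lt : ℝ → Matrix n n ℂ → Matrix n n ℂ) (s : ℝ) (ρ : ℝ → Matrix n n ℂ) : Prop :=
  ∀ t, s ≤ t → ∀ i j, HasDerivAt (fun u => ρ u i j) ((Lt t (ρ t)) i j) t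

/-- Density matrix: Hermitian, positive semidefinite, trace one. -/
def IsDensity (ρ : Matrix n n ℂ) : Prop := ρ.PosSemidef ∧ ρ.trace = 1

/-- Exponential contractivity with constants `K, γ` of a time-dependent Lindbladian. -/
def ExpContractiveWith (Lt : ℝ → Matrix n n ℂ → Matrix n n ℂ) (K γ : ℝ) : Prop :=
  ∀ s t : ℝ, 0 ≤ s → s ≤ t → ∀ ρ σ : ℝ → Matrix n n ℂ,
    IsSolution Lt s ρ → IsSolution Lt s σ → IsDensity (ρ s) → IsDensity (σ s) →
    traceNorm (ρ t - σ t) ≤ K * Real.exp (-γ * (t - s)) * traceNorm (ρ s - σ s)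

/-- Exponential contractivity of a time-dependent Lindbladian. -/
def ExpContractive (Lt : ℝ → Matrix n n ℂ → Matrix n n ℂ) : Prop :=
  ∃ K γ : ℝ, 0 < K ∧ 0 < γ ∧ ExpContractiveWith Lt K γ

/-- Time-dependent Hamiltonian: Hermitian values and continuous entries. -/
def IsHamiltonianFamily (H : ℝ → Matrix n n ℂ) : Prop :=
  (∀ t, (H t).IsHermitian) ∧ ∀ i j, Continuous fun t => H t i j

/-- Driven Lindbladian `x ↦ -i[H(t), x] + D(x)`. -/
noncomputable def driven {m : ℕ} (H : ℝ → Matrix n n ℂ) (L : Fin m → Matrix n n ℂ)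
    (t : ℝ) (x : Matrix n n ℂ) : Matrix n n ℂ :=
  hamTerm (H t) x + totalDissipator L x

/-- Hamiltonian-independent contractivity of a dissipator. -/
def HamIndepContractive {m : ℕ} (L : Fin m → Matrix n n ℂ) : Prop :=
  ∀ H : ℝ → Matrix n n ℂ, IsHamiltonianFamily H → ExpContractive (driven H L)

/-- The operator norm (largest singular value). -/
noncomputable def opNorm (A : Matrix n n ℂ) : ℝ :=
  ‖LinearMap.toContinuousLinearMap (Matrix.toEuclideanLin A)‖

end Paper

namespace Paper

/-- `r(D)`: infimum over orthonormal pairs `u ⊥ v` of `Σ_j |⟨v, L_j u⟩|²`. -/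
noncomputable def rconst {d m : ℕ} (L : Fin m → Matrix (Fin d) (Fin d) ℂ) : ℝ :=
  sInf { r : ℝ | ∃ u v : Fin d → ℂ,
    (∑ i, ‖u i‖ ^ 2) = 1 ∧ (∑ i, ‖v i‖ ^ 2) = 1 ∧ (star u ⬝ᵥ v) = 0 ∧
    r = ∑ j, ‖star v ⬝ᵥ (L j *ᵥ u)‖ ^ 2 }

/-- Orthonormal basis of column vectors. -/
def IsONB {d : ℕ} (V : Fin d → Fin d → ℂ) : Prop :=
  (∀ k l, star (V k) ⬝ᵥ V l = if k = l then 1 else 0) ∧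
    ∑ k, vecMulVec (V k) (star (V k)) = 1

/-- Quadratic form. -/
def qf {d : ℕ} (M : Matrix (Fin d) (Fin d) ℂ) (v : Fin d → ℂ) : ℂ := star v ⬝ᵥ (M *ᵥ v)

/-- Entrywise l1 norm. -/
noncomputable def entSum {d : ℕ} (M : Matrix (Fin d) (Fin d) ℂ) : ℝ := ∑ i, ∑ j, ‖M i j‖

lemma entSum_nonneg {d : ℕ} (M : Matrix (Fin d) (Fin d) ℂ) : 0 ≤ entSum M := by
  unfold entSum; positivity

lemma unitary_onb {d : ℕ} (U : Matrix (Fin d) (Fin d) ℂ) (h1 : Uᴴ * U = 1) (h2 : U * Uᴴ = 1) :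
    IsONB (fun k i => U i k) := by
  constructor
  · intro k l
    have := congrFun (congrFun h1 k) l
    simpa [Matrix.mul_apply, dotProduct, Matrix.one_apply] using this
  · ext i j
    have := congrFun (congrFun h2 i) j
    simpa [Matrix.mul_apply, vecMulVec_apply, Matrix.sum_apply] using this

lemma spectral {d : ℕ} (A : Matrix (Fin d) (Fin d) ℂ) (hA : A.IsHermitian) :
    ∃ (V : Fin d → Fin d → ℂ) (l : Fin d → ℝ), IsONB V ∧
      A = ∑ i, (l i : ℂ) • vecMulVec (V i) (star (V i)) ∧ traceNorm A = ∑ i, |l i| := by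
  set U : Matrix (Fin d) (Fin d) ℂ := ↑(hA.eigenvectorUnitary) with hU
  have h1 : Uᴴ * U = 1 := Unitary.coe_star_mul_self hA.eigenvectorUnitary
  have h2 : U * Uᴴ = 1 := Unitary.coe_mul_star_self hA.eigenvectorUnitary
  have hs : A = U * diagonal (RCLike.ofReal ∘ hA.eigenvalues) * Uᴴ := by
    conv_lhs => rw [hA.spectral_theorem, Unitary.conjStarAlgAut_apply]
    rfl
  refine ⟨fun k i => U i k, hA.eigenvalues, unitary_onb U h1 h2, ?_, ?_⟩
  · conv_lhs => rw [hs]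
    ext i j
    rw [Matrix.mul_apply]
    simp only [Matrix.mul_diagonal, Matrix.sum_apply, Matrix.smul_apply,
      vecMulVec_apply, conjTranspose_apply, Function.comp, Pi.star_apply, smul_eq_mul]
    refine Finset.sum_congr rfl fun k _ => ?_
    rw [RCLike.ofReal_eq_complex_ofReal]
    ring
  · have hsq : Aᴴ * A = U * diagonal (fun i => ((hA.eigenvalues i ^ 2 : ℝ) : ℂ)) * Uᴴ := by
      rw [hA.eq]
      conv_lhs => rw [hs]
      calc _ = U * diagonal (RCLike.ofReal ∘ hA.eigenvalues) * (Uᴴ * U) *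
            diagonal (RCLike.ofReal ∘ hA.eigenvalues) * Uᴴ := by simp only [Matrix.mul_assoc]
        _ = _ := by
          rw [h1, Matrix.mul_one, Matrix.mul_assoc U, diagonal_mul_diagonal]
          congr 3
          ext i
          simp [sq]
    have hroots := (Matrix.posSemidef_conjTranspose_mul_self A).isHermitian.roots_charpoly_eq_eigenvalues
    have hc : (Aᴴ * A).charpoly = ∏ i, (Polynomial.X - Polynomial.C ((hA.eigenvalues i ^ 2 : ℝ) : ℂ)) := by
      rw [hsq, Matrix.mul_assoc, Matrix.charpoly_mul_comm, Matrix.mul_assoc, h1, Matrix.mul_one,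
        Matrix.charpoly_diagonal]
    have hp : (∏ i, (Polynomial.X - Polynomial.C ((hA.eigenvalues i ^ 2 : ℝ) : ℂ))) =
        (Multiset.map (fun a => Polynomial.X - Polynomial.C a)
          (Multiset.map (fun i => ((hA.eigenvalues i ^ 2 : ℝ) : ℂ)) Finset.univ.val)).prod := by
      rw [Multiset.map_map]; rfl
    rw [hc, hp, Polynomial.roots_multiset_prod_X_sub_C] at hroots
    have := congrArg (fun s => (Multiset.map (fun z : ℂ => Real.sqrt z.re) s).sum) hroots
    simp only [Multiset.map_map, Function.comp_def] at this
    unfold traceNorm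
    rw [Finset.sum, Finset.sum]
    simp only [RCLike.ofReal_eq_complex_ofReal, Complex.ofReal_re, Real.sqrt_sq_eq_abs] at this
    simpa using this.symm

lemma qf_add {d : ℕ} (M N : Matrix (Fin d) (Fin d) ℂ) (v) : qf (M + N) v = qf M v + qf N v := by
  simp [qf, add_mulVec, dotProduct_add]

lemma qf_smul {d : ℕ} (c : ℂ) (M : Matrix (Fin d) (Fin d) ℂ) (v) : qf (c • M) v = c * qf M v := by
  simp [qf, smul_mulVec, dotProduct_smul]

lemma qf_sum {d : ℕ} {ι : Type*} (s : Finset ι) (M : ι → Matrix (Fin d) (Fin d) ℂ) (v) :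
    qf (∑ i ∈ s, M i) v = ∑ i ∈ s, qf (M i) v := by
  simp [qf, sum_mulVec, dotProduct_sum]

lemma onb_unit {d : ℕ} {V : Fin d → Fin d → ℂ} (hV : IsONB V) (k) : star (V k) ⬝ᵥ V k = 1 := by
  simp [hV.1]

lemma sum_qf {d : ℕ} {V : Fin d → Fin d → ℂ} (hV : IsONB V) (M : Matrix (Fin d) (Fin d) ℂ) :
    ∑ k, qf M (V k) = M.trace := by
  have : M.trace = (M * ∑ k, vecMulVec (V k) (star (V k))).trace := by rw [hV.2, Matrix.mul_one]
  rw [this, Finset.mul_sum, Matrix.trace_sum]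
  refine Finset.sum_congr rfl fun k _ => ?_
  rw [mul_vecMulVec, trace_vecMulVec, qf, dotProduct_comm]

lemma qf_proj {d : ℕ} (u v : Fin d → ℂ) :
    qf (vecMulVec u (star u)) v = ((‖star u ⬝ᵥ v‖ ^ 2 : ℝ) : ℂ) := by
  rw [qf, vecMulVec_mulVec, dotProduct_smul, ← Complex.normSq_eq_norm_sq, Complex.normSq_eq_conj_mul_self]
  have : (starRingEnd ℂ) (star u ⬝ᵥ v) = star v ⬝ᵥ u := by
    rw [starRingEnd_apply, star_dotProduct, star_star]
  rw [this]; simp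

lemma norm_sq_unit {d : ℕ} (u : Fin d → ℂ) : star u ⬝ᵥ u = ((∑ i, ‖u i‖ ^ 2 : ℝ) : ℂ) := by
  simp [dotProduct, ← Complex.conj_mul']

lemma entry_le {d : ℕ} {u : Fin d → ℂ} (hu : star u ⬝ᵥ u = 1) (i) : ‖u i‖ ≤ 1 := by
  rw [norm_sq_unit] at hu
  have hu : ∑ i, ‖u i‖ ^ 2 = 1 := by exact_mod_cast hu
  have := Finset.single_le_sum (f := fun i => ‖u i‖ ^ 2) (fun i _ => by positivity) (Finset.mem_univ i)
  rw [hu] at this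
  exact (sq_le_one_iff₀ (norm_nonneg _)).1 this

lemma sesq_le {d : ℕ} {u v : Fin d → ℂ} (hu : star u ⬝ᵥ u = 1) (hv : star v ⬝ᵥ v = 1)
    (M : Matrix (Fin d) (Fin d) ℂ) : ‖star v ⬝ᵥ (M *ᵥ u)‖ ≤ entSum M := by
  simp only [dotProduct, mulVec, entSum]
  refine (norm_sum_le _ _).trans (Finset.sum_le_sum fun i _ => ?_)
  rw [norm_mul]
  have h1 : ‖(star v) i‖ ≤ 1 := by simpa using entry_le hv i
  refine (mul_le_of_le_one_left (norm_nonneg _) h1).trans ?_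
  refine (norm_sum_le _ _).trans (Finset.sum_le_sum fun j _ => ?_)
  rw [norm_mul]
  exact mul_le_of_le_one_right (norm_nonneg _) (entry_le hu j)

lemma sum_norm_qf_le_ent {d : ℕ} {V : Fin d → Fin d → ℂ} (hV : IsONB V) (M : Matrix (Fin d) (Fin d) ℂ) :
    ∑ k, ‖qf M (V k)‖ ≤ d * entSum M := by
  refine (Finset.sum_le_sum fun k _ => sesq_le (onb_unit hV k) (onb_unit hV k) M).trans ?_
  simp

lemma trace_proj {d : ℕ} {u : Fin d → ℂ} (hu : star u ⬝ᵥ u = 1) :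
    (vecMulVec u (star u)).trace = 1 := by
  rw [trace_vecMulVec, dotProduct_comm, hu]

lemma sum_norm_qf_le {d : ℕ} {V : Fin d → Fin d → ℂ} (hV : IsONB V)
    {A : Matrix (Fin d) (Fin d) ℂ} (hA : A.IsHermitian) :
    ∑ k, ‖qf A (V k)‖ ≤ traceNorm A := by
  obtain ⟨W, l, hW, hAe, hN⟩ := spectral A hA
  rw [hN]
  calc ∑ k, ‖qf A (V k)‖ ≤ ∑ k, ∑ i, |l i| * ‖star (W i) ⬝ᵥ V k‖ ^ 2 := by
        refine Finset.sum_le_sum fun k _ => ?_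
        rw [hAe, qf_sum]
        refine (norm_sum_le _ _).trans (Finset.sum_le_sum fun i _ => ?_)
        rw [qf_smul, qf_proj, norm_mul, Complex.norm_real, Complex.norm_real]
        simp
    _ = ∑ i, |l i| * ∑ k, ‖star (W i) ⬝ᵥ V k‖ ^ 2 := by
        rw [Finset.sum_comm]; simp only [Finset.mul_sum]
    _ = ∑ i, |l i| := by
        refine Finset.sum_congr rfl fun i _ => ?_
        have := sum_qf hV (vecMulVec (W i) (star (W i)))
        rw [trace_proj (onb_unit hW i)] at this
        simp only [qf_proj] at this
        have h : ∑ k, ‖star (W i) ⬝ᵥ V k‖ ^ 2 = 1 := by exact_mod_cast this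
        rw [h, mul_one]

lemma exists_onb {d : ℕ} {A : Matrix (Fin d) (Fin d) ℂ} (hA : A.IsHermitian) :
    ∃ V, IsONB V ∧ traceNorm A = ∑ k, ‖qf A (V k)‖ := by
  obtain ⟨W, l, hW, hAe, hN⟩ := spectral A hA
  refine ⟨W, hW, ?_⟩
  rw [hN]
  refine Finset.sum_congr rfl fun k _ => ?_
  have : qf A (W k) = l k := by
    rw [hAe, qf_sum]
    simp only [qf_smul, qf_proj, hW.1]
    rw [Finset.sum_eq_single k]
    · simp
    · intro b _ hb; simp [hb]
    · simp
  rw [this, Complex.norm_real, Real.norm_eq_abs]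

lemma traceNorm_le_add {d : ℕ} {A B : Matrix (Fin d) (Fin d) ℂ} (hA : A.IsHermitian)
    (hB : B.IsHermitian) : traceNorm A ≤ traceNorm B + d * entSum (A - B) := by
  obtain ⟨V, hV, h⟩ := exists_onb hA
  have e : A = B + (A - B) := by abel
  rw [h]
  calc ∑ k, ‖qf A (V k)‖ ≤ ∑ k, (‖qf B (V k)‖ + ‖qf (A - B) (V k)‖) := by
        refine Finset.sum_le_sum fun k _ => ?_
        conv_lhs => rw [e, qf_add]
        exact norm_add_le _ _
    _ ≤ _ := by
        rw [Finset.sum_add_distrib]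
        exact add_le_add (sum_norm_qf_le hV hB) (sum_norm_qf_le_ent hV _)

/-- Effective non-Hermitian drift. -/
noncomputable def drift {d m : ℕ} (H : Matrix (Fin d) (Fin d) ℂ) (L : Fin m → Matrix (Fin d) (Fin d) ℂ) :
    Matrix (Fin d) (Fin d) ℂ := (-Complex.I) • H - ((1 : ℂ) / 2) • ∑ j, (L j)ᴴ * L j

/-- Generator. -/
def gen {d m : ℕ} (G : Matrix (Fin d) (Fin d) ℂ) (L : Fin m → Matrix (Fin d) (Fin d) ℂ)
    (x : Matrix (Fin d) (Fin d) ℂ) : Matrix (Fin d) (Fin d) ℂ :=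
  G * x + x * Gᴴ + ∑ j, L j * x * (L j)ᴴ

lemma driven_eq {d m : ℕ} {H : ℝ → Matrix (Fin d) (Fin d) ℂ} (L : Fin m → Matrix (Fin d) (Fin d) ℂ)
    {t : ℝ} (hH : (H t).IsHermitian) (x : Matrix (Fin d) (Fin d) ℂ) :
    driven H L t x = gen (drift (H t) L) L x := by
  have h1 : (drift (H t) L)ᴴ = Complex.I • H t - ((1 : ℂ) / 2) • ∑ j, (L j)ᴴ * L j := by
    simp [drift, conjTranspose_sum, hH.eq]
  rw [gen, h1, driven, hamTerm, totalDissipator, drift]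
  simp only [dissipator, Finset.sum_sub_distrib, ← Finset.smul_sum, Finset.sum_add_distrib,
    Matrix.sub_mul, Matrix.mul_sub, Matrix.smul_mul, Matrix.mul_smul, Finset.sum_mul,
    Finset.mul_sum]
  module

lemma trace_driven {d m : ℕ} (H : ℝ → Matrix (Fin d) (Fin d) ℂ) (L : Fin m → Matrix (Fin d) (Fin d) ℂ)
    (t : ℝ) (x : Matrix (Fin d) (Fin d) ℂ) : (driven H L t x).trace = 0 := by
  simp only [driven, hamTerm, totalDissipator, dissipator, trace_add, trace_smul, trace_sub,
    trace_sum]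
  rw [trace_mul_comm (H t) x, sub_self, smul_zero, zero_add]
  refine Finset.sum_eq_zero fun j _ => ?_
  rw [trace_mul_comm x, trace_mul_cycle (L j) x, smul_eq_mul]
  ring

lemma gen_sum {d m : ℕ} (G : Matrix (Fin d) (Fin d) ℂ) (L : Fin m → Matrix (Fin d) (Fin d) ℂ)
    (l : Fin d → ℂ) (P : Fin d → Matrix (Fin d) (Fin d) ℂ) :
    gen G L (∑ i, l i • P i) = ∑ i, l i • gen G L (P i) := by
  simp only [gen, Finset.mul_sum, Finset.sum_mul, Matrix.mul_smul, Matrix.smul_mul, smul_add,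
    Finset.sum_add_distrib, Finset.smul_sum]
  congr 1
  exact Finset.sum_comm

lemma gen_sub {d m : ℕ} (G : Matrix (Fin d) (Fin d) ℂ) (L : Fin m → Matrix (Fin d) (Fin d) ℂ) (x y) :
    gen G L (x - y) = gen G L x - gen G L y := by
  simp only [gen, Matrix.mul_sub, Matrix.sub_mul, Finset.sum_sub_distrib]
  abel

lemma gen_smul {d m : ℕ} (G : Matrix (Fin d) (Fin d) ℂ) (L : Fin m → Matrix (Fin d) (Fin d) ℂ) (c : ℂ) (x) :
    gen G L (c • x) = c • gen G L x := by
  simp only [gen, Matrix.mul_smul, Matrix.smul_mul, smul_add, Finset.smul_sum]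

lemma gen_conj {d m : ℕ} (G : Matrix (Fin d) (Fin d) ℂ) (L : Fin m → Matrix (Fin d) (Fin d) ℂ) (x) :
    gen G L xᴴ = (gen G L x)ᴴ := by
  simp only [gen, conjTranspose_add, conjTranspose_mul, conjTranspose_sum, conjTranspose_conjTranspose,
    Matrix.mul_assoc]
  rw [add_comm (G * xᴴ)]

lemma norm_dot_comm {d : ℕ} (u v : Fin d → ℂ) : ‖star u ⬝ᵥ v‖ = ‖star v ⬝ᵥ u‖ := by
  rw [← norm_star, star_dotProduct, star_star]

lemma qf_gen {d m : ℕ} (G : Matrix (Fin d) (Fin d) ℂ) (L : Fin m → Matrix (Fin d) (Fin d) ℂ)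
    (u v : Fin d → ℂ) :
    qf (gen G L (vecMulVec u (star u))) v =
      ((2 * ((star v ⬝ᵥ (G *ᵥ u)) * (star u ⬝ᵥ v)).re + ∑ j, ‖star v ⬝ᵥ (L j *ᵥ u)‖ ^ 2 : ℝ) : ℂ) := by
  have hL : ∀ j, qf (L j * vecMulVec u (star u) * (L j)ᴴ) v = ((‖star v ⬝ᵥ (L j *ᵥ u)‖ ^ 2 : ℝ) : ℂ) := by
    intro j
    rw [mul_vecMulVec, vecMulVec_mul, ← star_mulVec, qf_proj, norm_dot_comm]
  have h1 : qf (G * vecMulVec u (star u)) v = (star v ⬝ᵥ (G *ᵥ u)) * (star u ⬝ᵥ v) := by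
    rw [mul_vecMulVec, qf, vecMulVec_mulVec, dotProduct_smul]; simp [mul_comm]
  have h2 : qf (vecMulVec u (star u) * Gᴴ) v = star ((star v ⬝ᵥ (G *ᵥ u)) * (star u ⬝ᵥ v)) := by
    rw [vecMulVec_mul, ← star_mulVec, qf, vecMulVec_mulVec, dotProduct_smul, star_mul]
    have a1 : star (star u ⬝ᵥ v) = star v ⬝ᵥ u := by rw [star_dotProduct, star_star]
    have a2 : star (star v ⬝ᵥ (G *ᵥ u)) = star (G *ᵥ u) ⬝ᵥ v := by rw [star_dotProduct, star_star]
    rw [a1, a2]; simp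
  rw [gen, qf_add, qf_add, qf_sum, h1, h2]
  simp only [hL]
  rw [← starRingEnd_apply (star v ⬝ᵥ (G *ᵥ u) * star u ⬝ᵥ v), Complex.add_conj]
  push_cast
  rfl

lemma rconst_le {d m : ℕ} (L : Fin m → Matrix (Fin d) (Fin d) ℂ) (u w : Fin d → ℂ)
    (hu : star u ⬝ᵥ u = 1) (huw : star u ⬝ᵥ w = 0) :
    rconst L * (∑ i, ‖w i‖ ^ 2) ≤ ∑ j, ‖star w ⬝ᵥ (L j *ᵥ u)‖ ^ 2 := by
  set N := ∑ i, ‖w i‖ ^ 2 with hN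
  have hN0 : 0 ≤ N := by positivity
  rcases hN0.eq_or_lt with h0 | hpos
  · rw [← h0, mul_zero]; positivity
  · rw [← le_div_iff₀ hpos]
    apply csInf_le
    · refine ⟨0, ?_⟩
      rintro r ⟨u, v, -, -, -, rfl⟩
      positivity
    · have hs : ‖(((Real.sqrt N)⁻¹ : ℝ) : ℂ)‖ ^ 2 = N⁻¹ := by
        rw [Complex.norm_real, Real.norm_eq_abs, sq_abs, inv_pow, Real.sq_sqrt hN0]
      refine ⟨u, (((Real.sqrt N)⁻¹ : ℝ) : ℂ) • w, ?_, ?_, ?_, ?_⟩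
      · rw [norm_sq_unit] at hu; exact_mod_cast hu
      · simp only [Pi.smul_apply, smul_eq_mul, norm_mul, mul_pow, hs]
        rw [← Finset.mul_sum, ← hN, inv_mul_cancel₀ hpos.ne']
      · rw [dotProduct_smul, huw, smul_zero]
      · simp only [star_smul, smul_dotProduct, smul_eq_mul, norm_mul, mul_pow, norm_star, hs]
        rw [← Finset.mul_sum, div_eq_inv_mul]

lemma proj_bound {d m : ℕ} (G : Matrix (Fin d) (Fin d) ℂ) (L : Fin m → Matrix (Fin d) (Fin d) ℂ)
    (u v : Fin d → ℂ) (hu : star u ⬝ᵥ u = 1) (hv : star v ⬝ᵥ v = 1) :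
    rconst L * (1 - ‖star u ⬝ᵥ v‖ ^ 2) - (2 * entSum G + ∑ j, 4 * entSum (L j) ^ 2) * ‖star u ⬝ᵥ v‖ ≤
      2 * ((star v ⬝ᵥ (G *ᵥ u)) * (star u ⬝ᵥ v)).re + ∑ j, ‖star v ⬝ᵥ (L j *ᵥ u)‖ ^ 2 := by
  set α := star u ⬝ᵥ v with hα
  set w := v - α • u with hw
  have huw : star u ⬝ᵥ w = 0 := by
    rw [hw, dotProduct_sub, dotProduct_smul, hu, ← hα]; simp
  have hN : ∑ i, ‖w i‖ ^ 2 = 1 - ‖α‖ ^ 2 := by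
    have h1 : star w ⬝ᵥ w = 1 - ((‖α‖ ^ 2 : ℝ) : ℂ) := by
      conv_lhs => rw [hw]
      rw [← hw, star_sub, sub_dotProduct, star_smul, smul_dotProduct, huw, smul_zero, sub_zero, hw,
        dotProduct_sub, dotProduct_smul, hv, ← qf_proj, qf, vecMulVec_mulVec, dotProduct_smul, ← hα]
      simp [mul_comm]
    rw [norm_sq_unit] at h1
    exact_mod_cast h1
  have hα1 : ‖α‖ ^ 2 ≤ 1 := by
    have : 0 ≤ ∑ i, ‖w i‖ ^ 2 := by positivity
    linarith
  have hα1' : ‖α‖ ≤ 1 := (sq_le_one_iff₀ (norm_nonneg _)).1 hα1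
  have hr := rconst_le L u w hu huw
  rw [hN] at hr
  have hG : -(entSum G * ‖α‖) ≤ ((star v ⬝ᵥ (G *ᵥ u)) * α).re := by
    have h1 := Complex.abs_re_le_norm ((star v ⬝ᵥ (G *ᵥ u)) * α)
    rw [norm_mul] at h1
    have h2 := mul_le_mul_of_nonneg_right (sesq_le hu hv G) (norm_nonneg α)
    have := neg_abs_le ((star v ⬝ᵥ (G *ᵥ u)) * α).re
    linarith
  have hj : ∀ j, ‖star w ⬝ᵥ (L j *ᵥ u)‖ ^ 2 - 4 * entSum (L j) ^ 2 * ‖α‖ ≤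
      ‖star v ⬝ᵥ (L j *ᵥ u)‖ ^ 2 := by
    intro j
    have e : star w ⬝ᵥ (L j *ᵥ u) = star v ⬝ᵥ (L j *ᵥ u) - star α * (star u ⬝ᵥ (L j *ᵥ u)) := by
      rw [hw, star_sub, sub_dotProduct, star_smul, smul_dotProduct, smul_eq_mul]
    have h1 : ‖star w ⬝ᵥ (L j *ᵥ u)‖ ≤ ‖star v ⬝ᵥ (L j *ᵥ u)‖ + ‖α‖ * ‖star u ⬝ᵥ (L j *ᵥ u)‖ := by
      rw [e]
      refine (norm_sub_le _ _).trans ?_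
      rw [norm_mul, norm_star]
    have h2 := sesq_le hu hu (L j)
    have h3 := sesq_le hu hv (L j)
    set E := entSum (L j)
    set a := ‖α‖
    have ha : 0 ≤ a := norm_nonneg _
    have hE : 0 ≤ E := entSum_nonneg _
    set X := ‖star v ⬝ᵥ (L j *ᵥ u)‖
    set Y := ‖star w ⬝ᵥ (L j *ᵥ u)‖
    have hX : 0 ≤ X := norm_nonneg _
    have hY : 0 ≤ Y := norm_nonneg _
    have h4 : Y ≤ X + a * E := h1.trans (by gcongr)
    have h5 : Y ^ 2 ≤ (X + a * E) ^ 2 := by gcongr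
    have h6 : X * (a * E) ≤ E * (a * E) := by gcongr
    have h7 : a * (a * E ^ 2) ≤ 1 * (a * E ^ 2) := by gcongr
    have h8 : 0 ≤ a * E ^ 2 := by positivity
    nlinarith
  have hsum := Finset.sum_le_sum fun j (_ : j ∈ Finset.univ) => hj j
  rw [Finset.sum_sub_distrib, ← Finset.sum_mul] at hsum
  linarith

/-- constant -/
noncomputable def cst {d m : ℕ} (G : Matrix (Fin d) (Fin d) ℂ) (L : Fin m → Matrix (Fin d) (Fin d) ℂ) : ℝ :=
  2 * entSum G + ∑ j, 4 * entSum (L j) ^ 2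

lemma proj_sum {d m : ℕ} (G : Matrix (Fin d) (Fin d) ℂ) (L : Fin m → Matrix (Fin d) (Fin d) ℂ)
    (htr : ∀ x, (gen G L x).trace = 0)
    (u : Fin d → ℂ) (hu : star u ⬝ᵥ u = 1) {V : Fin d → Fin d → ℂ} (hV : IsONB V)
    (h : ℝ) (h0 : 0 ≤ h) (hh : h * rconst L ≤ 1 / 2) :
    ∑ k, ‖qf (vecMulVec u (star u) + (h : ℂ) • gen G L (vecMulVec u (star u))
      + ((-(h * rconst L) : ℝ) : ℂ) • 1) (V k)‖ ≤ 1 - d * rconst L * h + d * (cst G L) ^ 2 * h ^ 2 := by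
  set M := vecMulVec u (star u) + (h : ℂ) • gen G L (vecMulVec u (star u))
      + ((-(h * rconst L) : ℝ) : ℂ) • 1 with hM
  have hk : ∀ k, ‖qf M (V k)‖ ≤ (qf M (V k)).re + (cst G L) ^ 2 * h ^ 2 := by
    intro k
    have hv := onb_unit hV k
    have hb := proj_bound G L u (V k) hu hv
    have e1 : qf 1 (V k) = 1 := by rw [qf, one_mulVec, hv]
    set B := 2 * ((star (V k) ⬝ᵥ (G *ᵥ u)) * (star u ⬝ᵥ (V k))).re + ∑ j, ‖star (V k) ⬝ᵥ (L j *ᵥ u)‖ ^ 2 with hB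
    set a := ‖star u ⬝ᵥ (V k)‖ with ha
    have e : qf M (V k) = ((a ^ 2 + h * B - h * rconst L : ℝ) : ℂ) := by
      rw [hM, qf_add, qf_add, qf_smul, qf_smul, qf_gen, qf_proj, e1, ← hB, ← ha]
      push_cast; ring
    rw [e, Complex.norm_real, Complex.ofReal_re, Real.norm_eq_abs]
    rw [← cst] at hb
    set C := cst G L
    have h1 : h * (rconst L * (1 - a ^ 2) - C * a) ≤ h * B := by gcongr
    have h2 : h * rconst L * a ^ 2 ≤ 1 / 2 * a ^ 2 := by gcongr
    have h3 : -(C ^ 2 * h ^ 2 / 2) ≤ a ^ 2 + h * B - h * rconst L := by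
      nlinarith [sq_nonneg (a - C * h)]
    rw [abs_le]
    constructor <;> nlinarith [sq_nonneg (C * h)]
  refine (Finset.sum_le_sum fun k _ => hk k).trans ?_
  rw [Finset.sum_add_distrib, ← Complex.re_sum, sum_qf hV]
  have : M.trace = ((1 - d * rconst L * h : ℝ) : ℂ) := by
    rw [hM, trace_add, trace_add, trace_smul, trace_smul, htr, trace_proj hu, trace_one]
    simp; ring
  rw [this, Complex.ofReal_re]
  simp
  linarith

lemma step {d m : ℕ} (G : Matrix (Fin d) (Fin d) ℂ) (L : Fin m → Matrix (Fin d) (Fin d) ℂ)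
    (htr : ∀ x, (gen G L x).trace = 0)
    {x : Matrix (Fin d) (Fin d) ℂ} (hx : x.IsHermitian) (hx0 : x.trace = 0)
    {V : Fin d → Fin d → ℂ} (hV : IsONB V)
    (h : ℝ) (h0 : 0 ≤ h) (hh : h * rconst L ≤ 1 / 2) :
    ∑ k, ‖qf (x + (h : ℂ) • gen G L x) (V k)‖ ≤
      (1 - d * rconst L * h + d * (cst G L) ^ 2 * h ^ 2) * traceNorm x := by
  obtain ⟨W, l, hW, hAe, hN⟩ := spectral x hx
  have hl : ∑ i, (l i : ℂ) = 0 := by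
    rw [hAe, trace_sum] at hx0
    simpa [trace_smul, trace_proj (onb_unit hW _)] using hx0
  set P : Fin d → Matrix (Fin d) (Fin d) ℂ := fun i => vecMulVec (W i) (star (W i)) with hP
  have e : x + (h : ℂ) • gen G L x = ∑ i, (l i : ℂ) • (P i + (h : ℂ) • gen G L (P i)
      + ((-(h * rconst L) : ℝ) : ℂ) • 1) := by
    simp only [smul_add, Finset.sum_add_distrib]
    rw [← Finset.sum_smul, hl, zero_smul, add_zero, hAe, gen_sum, Finset.smul_sum]
    congr 1
    refine Finset.sum_congr rfl fun i _ => smul_comm _ _ _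
  rw [e, hN, Finset.mul_sum]
  calc _ ≤ ∑ k, ∑ i, |l i| * ‖qf (P i + (h : ℂ) • gen G L (P i)
      + ((-(h * rconst L) : ℝ) : ℂ) • 1) (V k)‖ := by
        refine Finset.sum_le_sum fun k _ => ?_
        rw [qf_sum]
        refine (norm_sum_le _ _).trans (Finset.sum_le_sum fun i _ => ?_)
        rw [qf_smul, norm_mul, Complex.norm_real, Real.norm_eq_abs]
    _ = ∑ i, |l i| * ∑ k, ‖qf (P i + (h : ℂ) • gen G L (P i)
      + ((-(h * rconst L) : ℝ) : ℂ) • 1) (V k)‖ := by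
        rw [Finset.sum_comm]; simp only [Finset.mul_sum]
    _ ≤ _ := by
        refine Finset.sum_le_sum fun i _ => ?_
        rw [mul_comm]
        exact mul_le_mul_of_nonneg_right (proj_sum G L htr (W i) (onb_unit hW i) hV h h0 hh) (abs_nonneg _)

lemma traceNorm_step {d m : ℕ} (G : Matrix (Fin d) (Fin d) ℂ) (L : Fin m → Matrix (Fin d) (Fin d) ℂ)
    (htr : ∀ x, (gen G L x).trace = 0)
    {x z : Matrix (Fin d) (Fin d) ℂ} (hx : x.IsHermitian) (hx0 : x.trace = 0) (hz : z.IsHermitian)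
    (h : ℝ) (h0 : 0 ≤ h) (hh : h * rconst L ≤ 1 / 2) :
    traceNorm z ≤ (1 - d * rconst L * h + d * (cst G L) ^ 2 * h ^ 2) * traceNorm x
      + d * entSum (z - (x + (h : ℂ) • gen G L x)) := by
  obtain ⟨V, hV, hN⟩ := exists_onb hz
  set y := x + (h : ℂ) • gen G L x with hy
  have e : z = y + (z - y) := by abel
  rw [hN]
  calc ∑ k, ‖qf z (V k)‖ ≤ ∑ k, (‖qf y (V k)‖ + ‖qf (z - y) (V k)‖) := by
        refine Finset.sum_le_sum fun k _ => ?_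
        conv_lhs => rw [e, qf_add]
        exact norm_add_le _ _
    _ ≤ _ := by
        rw [Finset.sum_add_distrib]
        exact add_le_add (step G L htr hx hx0 hV h h0 hh) (sum_norm_qf_le_ent hV _)

open Filter Topology in
lemma core {d m : ℕ} (L : Fin m → Matrix (Fin d) (Fin d) ℂ)
    (H : ℝ → Matrix (Fin d) (Fin d) ℂ) (hH : ∀ t, (H t).IsHermitian) (s t : ℝ) (hst : s ≤ t)
    (x : ℝ → Matrix (Fin d) (Fin d) ℂ) (hx : IsSolution (driven H L) s x)
    (hherm : ∀ u, s ≤ u → (x u).IsHermitian) (htr : ∀ u, s ≤ u → (x u).trace = 0) :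
    traceNorm (x t) ≤ Real.exp (-((d : ℝ) * rconst L) * (t - s)) * traceNorm (x s) := by
  have key := le_gronwallBound_of_liminf_deriv_right_le (f := fun u => traceNorm (x u))
    (f' := fun u => -((d : ℝ) * rconst L) * traceNorm (x u)) (δ := traceNorm (x s))
    (K := -((d : ℝ) * rconst L)) (ε := 0) (a := s) (b := t) ?_ ?_ le_rfl
    (fun u _ => by simp) t ⟨hst, le_rfl⟩
  · rw [gronwallBound_ε0] at key
    rw [mul_comm]; exact key
  · intro u hu
    have hc : Tendsto (fun z => (d : ℝ) * entSum (x z - x u)) (𝓝[Set.Icc s t] u) (𝓝 0) := by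
      have : Tendsto (fun z => (d : ℝ) * entSum (x z - x u)) (𝓝 u) (𝓝 ((d : ℝ) * entSum (x u - x u))) := by
        refine Tendsto.const_mul _ ?_
        unfold entSum
        refine tendsto_finsetSum _ fun i _ => tendsto_finsetSum _ fun j _ => ?_
        exact ((hx u hu.1 i j).continuousAt.tendsto.sub tendsto_const_nhds).norm
      have h0 : (d : ℝ) * entSum (x u - x u) = 0 := by simp [entSum]
      rw [h0] at this
      exact this.mono_left nhdsWithin_le_nhds
    have hsymm : ∀ A B : Matrix (Fin d) (Fin d) ℂ, entSum (A - B) = entSum (B - A) := by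
      intro A B
      unfold entSum
      simp only [Matrix.sub_apply, norm_sub_rev]
    refine tendsto_iff_dist_tendsto_zero.2 (squeeze_zero' (Eventually.of_forall fun _ => dist_nonneg) ?_ hc)
    filter_upwards [self_mem_nhdsWithin] with z hz
    rw [Real.dist_eq, abs_le]
    have h1 := traceNorm_le_add (hherm z hz.1) (hherm u hu.1)
    have h2 := traceNorm_le_add (hherm u hu.1) (hherm z hz.1)
    rw [hsymm] at h2
    constructor <;> linarith
  · intro u hu r hr
    set G := drift (H u) L with hG
    have hgen : ∀ y, driven H L u y = gen G L y := driven_eq L (hH u)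
    have htr0 : ∀ y, (gen G L y).trace = 0 := fun y => by rw [← hgen, trace_driven]
    set N := traceNorm (x u) with hN
    have hrem : Tendsto (fun z => ∑ i, ∑ j, ‖slope (fun z => x z i j) u z - gen G L (x u) i j‖)
        (𝓝[>] u) (𝓝 0) := by
      have : (0 : ℝ) = ∑ i : Fin d, ∑ j : Fin d, ‖gen G L (x u) i j - gen G L (x u) i j‖ := by simp
      rw [this]
      refine tendsto_finsetSum _ fun i _ => tendsto_finsetSum _ fun j _ => ?_
      have h1 := hasDerivAt_iff_tendsto_slope.1 (hx u hu.1 i j)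
      rw [hgen] at h1
      exact ((h1.mono_left (nhdsWithin_mono _ fun z (hz : u < z) => ne_of_gt hz)).sub tendsto_const_nhds).norm
    have hz : Tendsto (fun z : ℝ => z - u) (𝓝[>] u) (𝓝 0) := by
      have : Tendsto (fun z : ℝ => z - u) (𝓝 u) (𝓝 (u - u)) := tendsto_id.sub tendsto_const_nhds
      rw [sub_self] at this
      exact this.mono_left nhdsWithin_le_nhds
    have hlim : Tendsto (fun z => -((d : ℝ) * rconst L) * N + d * (cst G L) ^ 2 * N * (z - u)
        + d * ∑ i, ∑ j, ‖slope (fun z => x z i j) u z - gen G L (x u) i j‖) (𝓝[>] u)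
        (𝓝 (-((d : ℝ) * rconst L) * N)) := by
      have := ((hz.const_mul (d * (cst G L) ^ 2 * N)).const_add (-((d : ℝ) * rconst L) * N)).add
        (hrem.const_mul (d : ℝ))
      simpa using this
    have hsmall : ∀ᶠ z in 𝓝[>] u, (z - u) * rconst L < 1 / 2 := by
      have := hz.mul_const (rconst L)
      rw [zero_mul] at this
      exact this.eventually (gt_mem_nhds (by norm_num))
    refine Eventually.frequently ?_
    filter_upwards [hlim.eventually (gt_mem_nhds hr), hsmall, self_mem_nhdsWithin] with z h1 h2 h3
    have h3 : u < z := h3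
    refine lt_of_le_of_lt ?_ h1
    have hpos : 0 < z - u := sub_pos.2 h3
    rw [inv_mul_le_iff₀ hpos]
    have h4 := traceNorm_step G L htr0 (hherm u hu.1) (htr u hu.1) (hherm z (hu.1.trans h3.le))
      (z - u) hpos.le h2.le
    have h5 : entSum (x z - (x u + ((z - u : ℝ) : ℂ) • gen G L (x u))) =
        (z - u) * ∑ i, ∑ j, ‖slope (fun z => x z i j) u z - gen G L (x u) i j‖ := by
      unfold entSum
      rw [Finset.mul_sum]
      refine Finset.sum_congr rfl fun i _ => ?_
      rw [Finset.mul_sum]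
      refine Finset.sum_congr rfl fun j _ => ?_
      have : x z i j = x u i j + ((z - u : ℝ) : ℂ) * slope (fun z => x z i j) u z := by
        rw [← smul_eq_mul, Complex.coe_smul, sub_smul_slope]; simp
      rw [Matrix.sub_apply, Matrix.add_apply, Matrix.smul_apply, this, smul_eq_mul, add_sub_add_left_eq_sub,
        ← mul_sub, norm_mul, Complex.norm_real, Real.norm_of_nonneg hpos.le]
    rw [h5] at h4
    nlinarith

lemma traceNorm_eq_zero {d : ℕ} {A : Matrix (Fin d) (Fin d) ℂ} (hA : A.IsHermitian)
    (h : traceNorm A ≤ 0) : A = 0 := by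
  obtain ⟨V, l, hV, hAe, hN⟩ := spectral A hA
  have h0 : ∑ i, |l i| = 0 := le_antisymm (hN ▸ h) (by positivity)
  have hl : ∀ i, l i = 0 := fun i =>
    abs_eq_zero.1 ((Finset.sum_eq_zero_iff_of_nonneg (fun i _ => abs_nonneg (l i))).1 h0 i (Finset.mem_univ i))
  rw [hAe]; simp [hl]

lemma traceNorm_zero' {d : ℕ} : traceNorm (0 : Matrix (Fin d) (Fin d) ℂ) = 0 := by
  obtain ⟨V, hV, h⟩ := exists_onb (A := (0 : Matrix (Fin d) (Fin d) ℂ)) Matrix.isHermitian_zero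
  rw [h]; simp [qf]

lemma trace_const {d m : ℕ} (L : Fin m → Matrix (Fin d) (Fin d) ℂ)
    (H : ℝ → Matrix (Fin d) (Fin d) ℂ) (s t : ℝ) (hst : s ≤ t)
    (x : ℝ → Matrix (Fin d) (Fin d) ℂ) (hx : IsSolution (driven H L) s x) :
    (x t).trace = (x s).trace := by
  have hd : ∀ u, s ≤ u → HasDerivAt (fun z => (x z).trace) 0 u := by
    intro u hu
    have h1 : HasDerivAt (fun z => ∑ i, x z i i) (∑ i, driven H L u (x u) i i) u :=
      HasDerivAt.fun_sum fun i _ => hx u hu i i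
    have h2 := trace_driven H L u (x u)
    rw [Matrix.trace] at h2
    simp only [Matrix.diag] at h2
    rw [h2] at h1
    exact h1
  exact constant_of_has_deriv_right_zero (f := fun z => (x z).trace) (a := s) (b := t)
    (fun u hu => (hd u hu.1).continuousAt.continuousWithinAt)
    (fun u hu => (hd u hu.1).hasDerivWithinAt) t ⟨hst, le_rfl⟩

lemma main_bound {d m : ℕ} (L : Fin m → Matrix (Fin d) (Fin d) ℂ)
    (H : ℝ → Matrix (Fin d) (Fin d) ℂ) (hH : ∀ t, (H t).IsHermitian) (s t : ℝ) (hst : s ≤ t)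
    (x : ℝ → Matrix (Fin d) (Fin d) ℂ) (hx : IsSolution (driven H L) s x)
    (hs : (x s).IsHermitian) (htr : (x s).trace = 0) :
    traceNorm (x t) ≤ Real.exp (-((d : ℝ) * rconst L) * (t - s)) * traceNorm (x s) := by
  have hxt : ∀ u, s ≤ u → (x u).trace = 0 := fun u hu => by rw [trace_const L H s u hu x hx, htr]
  refine core L H hH s t hst x hx ?_ hxt
  set w : ℝ → Matrix (Fin d) (Fin d) ℂ := fun u => Complex.I • (x u - (x u)ᴴ) with hw
  have hwh : ∀ u, (w u).IsHermitian := by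
    intro u
    rw [Matrix.IsHermitian, hw]
    simp only [conjTranspose_smul, conjTranspose_sub, conjTranspose_conjTranspose, Complex.star_def,
      Complex.conj_I]
    module
  have hwt : ∀ u, s ≤ u → (w u).trace = 0 := by
    intro u hu
    simp [hw, trace_sub, trace_conjTranspose, hxt u hu]
  have hws : IsSolution (driven H L) s w := by
    intro u hu i j
    have e : driven H L u (w u) = Complex.I • (driven H L u (x u) - (driven H L u (x u))ᴴ) := by
      simp only [driven_eq L (hH u), hw]
      rw [gen_smul, gen_sub, gen_conj]
    rw [e]
    simp only [hw, Matrix.smul_apply, Matrix.sub_apply, conjTranspose_apply, smul_eq_mul]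
    exact ((hx u hu i j).sub (hx u hu j i).star).const_mul _
  have hw0 : w s = 0 := by simp [hw, hs.eq]
  intro u hu
  have h1 := core L H hH s u hu w hws (fun u _ => hwh u) hwt
  rw [hw0, traceNorm_zero', mul_zero] at h1
  have h2 := traceNorm_eq_zero (hwh u) h1
  have h3 : x u - (x u)ᴴ = 0 := by simpa [hw] using h2
  exact (sub_eq_zero.1 h3).symm

/-- if `r(D) > 0` then the dissipator is Hamiltonian-independently
contractive, with contraction rate at least `d·r(D)` and constant `K = 1`. -/
theorem r_pos_contractive {d m : ℕ} (L : Fin m → Matrix (Fin d) (Fin d) ℂ)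
    (hr : 0 < rconst L) :
    (∀ H : ℝ → Matrix (Fin d) (Fin d) ℂ, IsHamiltonianFamily H →
      ∀ s t : ℝ, 0 ≤ s → s ≤ t → ∀ ρ σ : ℝ → Matrix (Fin d) (Fin d) ℂ,
        IsSolution (driven H L) s ρ → IsSolution (driven H L) s σ →
        IsDensity (ρ s) → IsDensity (σ s) →
        traceNorm (ρ t - σ t) ≤
          Real.exp (-((d : ℝ) * rconst L) * (t - s)) * traceNorm (ρ s - σ s)) ∧
    HamIndepContractive L := by
  have main : ∀ H : ℝ → Matrix (Fin d) (Fin d) ℂ, IsHamiltonianFamily H →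
      ∀ s t : ℝ, 0 ≤ s → s ≤ t → ∀ ρ σ : ℝ → Matrix (Fin d) (Fin d) ℂ,
        IsSolution (driven H L) s ρ → IsSolution (driven H L) s σ →
        IsDensity (ρ s) → IsDensity (σ s) →
        traceNorm (ρ t - σ t) ≤
          Real.exp (-((d : ℝ) * rconst L) * (t - s)) * traceNorm (ρ s - σ s) := by
    intro H hH s t _ hst ρ σ hρ hσ hρs hσs
    refine main_bound L H hH.1 s t hst (fun u => ρ u - σ u) ?_ ?_ ?_
    · intro u hu i j
      have e : driven H L u (ρ u - σ u) = driven H L u (ρ u) - driven H L u (σ u) := by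
        simp only [driven_eq L (hH.1 u), gen_sub]
      rw [e]
      exact (hρ u hu i j).sub (hσ u hu i j)
    · exact hρs.1.isHermitian.sub hσs.1.isHermitian
    · rw [trace_sub, hρs.2, hσs.2, sub_self]
  refine ⟨main, fun H hH => ⟨1, d * rconst L, one_pos, ?_, ?_⟩⟩
  · have hd : d ≠ 0 := by
      rintro rfl
      simp [rconst] at hr
    positivity
  · intro s t hs hst ρ σ h1 h2 h3 h4
    rw [one_mul]
    exact main H hH s t hs hst ρ σ h1 h2 h3 h4

end Paper
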